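/- Let S⁰ be a quasi-ideal adequate transversal of an abundant semigroup S and let T = {(x,a) ∈ L × R : x̄ = ā} with multiplication (x,a)(y,b) = (e_x a y, a y f_b). Then the map φ : S → T given by xφ = (e_x x̄, x̄ f_x) is a semigroup isomorphism; in particular T is an abundant semigroup isomorphic to S. -/

import Mathlib

/-!
Common framework: "relative" semigroup-theoretic notions.  All notions are taken
relative to a carrier set `U` inside an ambient type, together with an explicit
binary operation `mul` (only the values of `mul` on `U` are relevant).  For an
honest semigroup `S` one takes `U = Set.univ` and `mul = mulOf S`.

* `RStarOn mul U a b` : the relation `a ℛ* b` computed in `U` with an identity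
  adjoined (the two clauses correspond to multipliers from `U` and to the
  adjoined identity).
* `LStarOn`, `GreenLOn`, `GreenROn` : dual / Green's relations.
* `AbundantOn`, `AdequateOn`, `LeftAdequateOn`, `RightAdequateOn`.
* `AdequateTransversalOn mul U S0` : `S0` is an adequate `*`-subsemigroup of `U`
  which is an adequate transversal, with the data `bar x = x̄`, `e x = e_x`,
  `f x = f_x`, and `plus s = s⁺`, `star s = s⋆` for `s ∈ S0`.
* `InverseTransversalOn mul U S0` : `S0` is an inverse transversal of the
  regular semigroup `U`, with `o x = x⁰` the unique inverse of `x` in `S0`.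
-/

namespace Paper

universe u

variable {α : Type*} {β : Type*} {γ : Type*}

def mulOf (α : Type*) [Mul α] : α → α → α := fun a b => a * b

/-- `x` is an idempotent for the operation `mul`. -/
def Idem (mul : α → α → α) (x : α) : Prop := mul x x = x

/-- The relation `ℛ*` on `U` (with an identity adjoined to `U`). -/
def RStarOn (mul : α → α → α) (U : Set α) (a b : α) : Prop :=
  (∀ x ∈ U, ∀ y ∈ U, (mul x a = mul y a ↔ mul x b = mul y b)) ∧
  (∀ x ∈ U, (mul x a = a ↔ mul x b = b))

/-- The relation `ℒ*` on `U` (with an identity adjoined to `U`). -/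
def LStarOn (mul : α → α → α) (U : Set α) (a b : α) : Prop :=
  (∀ x ∈ U, ∀ y ∈ U, (mul a x = mul a y ↔ mul b x = mul b y)) ∧
  (∀ x ∈ U, (mul a x = a ↔ mul b x = b))

/-- Green's relation `ℒ` on `U`: `U¹ a = U¹ b`. -/
def GreenLOn (mul : α → α → α) (U : Set α) (a b : α) : Prop :=
  (a = b ∨ ∃ u ∈ U, mul u b = a) ∧ (b = a ∨ ∃ v ∈ U, mul v a = b)

/-- Green's relation `ℛ` on `U`: `a U¹ = b U¹`. -/
def GreenROn (mul : α → α → α) (U : Set α) (a b : α) : Prop :=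
  (a = b ∨ ∃ u ∈ U, mul b u = a) ∧ (b = a ∨ ∃ v ∈ U, mul a v = b)

/-- `U` is closed under `mul`. -/
def ClosedOn (mul : α → α → α) (U : Set α) : Prop :=
  ∀ a ∈ U, ∀ b ∈ U, mul a b ∈ U

/-- `U` with the operation `mul` is a semigroup. -/
def SemigroupOn (mul : α → α → α) (U : Set α) : Prop :=
  ClosedOn mul U ∧ ∀ a ∈ U, ∀ b ∈ U, ∀ c ∈ U, mul (mul a b) c = mul a (mul b c)

/-- Every `ℛ*`-class and every `ℒ*`-class of `U` contains an idempotent. -/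
def AbundantOn (mul : α → α → α) (U : Set α) : Prop :=
  ∀ a ∈ U, (∃ e ∈ U, Idem mul e ∧ RStarOn mul U a e) ∧
           (∃ f ∈ U, Idem mul f ∧ LStarOn mul U a f)

/-- Abundant with commuting idempotents. -/
def AdequateOn (mul : α → α → α) (U : Set α) : Prop :=
  AbundantOn mul U ∧
    ∀ u ∈ U, ∀ v ∈ U, Idem mul u → Idem mul v → mul u v = mul v u

/-- Abundant, and every `ℛ*`-class contains a unique idempotent. -/
def LeftAdequateOn (mul : α → α → α) (U : Set α) : Prop :=
  AbundantOn mul U ∧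
    ∀ u ∈ U, ∀ v ∈ U, Idem mul u → Idem mul v → RStarOn mul U u v → u = v

/-- Abundant, and every `ℒ*`-class contains a unique idempotent. -/
def RightAdequateOn (mul : α → α → α) (U : Set α) : Prop :=
  AbundantOn mul U ∧
    ∀ u ∈ U, ∀ v ∈ U, Idem mul u → Idem mul v → LStarOn mul U u v → u = v

/-- `S0` is a quasi-ideal of `U` : `S0 U S0 ⊆ S0`. -/
def QuasiIdealOn (mul : α → α → α) (U S0 : Set α) : Prop :=
  ∀ s ∈ S0, ∀ x ∈ U, ∀ t ∈ S0, mul (mul s x) t ∈ S0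

/-- Every element of `U` has an inverse in `U`. -/
def RegularOn (mul : α → α → α) (U : Set α) : Prop :=
  ∀ x ∈ U, ∃ u ∈ U, mul (mul x u) x = x ∧ mul (mul u x) u = u

/-- Regular with commuting idempotents, i.e. an inverse semigroup. -/
def InverseSgpOn (mul : α → α → α) (U : Set α) : Prop :=
  RegularOn mul U ∧
    ∀ u ∈ U, ∀ v ∈ U, Idem mul u → Idem mul v → mul u v = mul v u

/-- Regular, and every Green `ℛ`-class contains a unique idempotent. -/
def LeftInverseSgpOn (mul : α → α → α) (U : Set α) : Prop :=
  RegularOn mul U ∧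
    ∀ u ∈ U, ∀ v ∈ U, Idem mul u → Idem mul v → GreenROn mul U u v → u = v

/-- Regular, and every Green `ℒ`-class contains a unique idempotent. -/
def RightInverseSgpOn (mul : α → α → α) (U : Set α) : Prop :=
  RegularOn mul U ∧
    ∀ u ∈ U, ∀ v ∈ U, Idem mul u → Idem mul v → GreenLOn mul U u v → u = v

/-- An isomorphism from `(A, mulA)` onto `(B, mulB)`. -/
def IsoOn (mulA : α → α → α) (mulB : β → β → β) (A : Set α) (B : Set β) : Prop :=
  ∃ θ : α → β, Set.BijOn θ A B ∧ ∀ a ∈ A, ∀ b ∈ A, θ (mulA a b) = mulB (θ a) (θ b)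

/-- `S0` is an adequate transversal of the abundant semigroup `U`.  `S0` is an
adequate `*`-subsemigroup of `U` (witnessed by `plus`/`star`, the canonical
idempotents `a⁺ ℛ* a`, `a⋆ ℒ* a` of elements of `S0`, the `ℛ*`/`ℒ*` relations
being those of the big semigroup `U`, which gives the `*`-subsemigroup property),
and every `x ∈ U` factors uniquely as `x = e_x x̄ f_x` with `x̄ ∈ S0`,
`e_x, f_x` idempotents of `U`, `e_x ℒ x̄⁺` and `f_x ℛ x̄⋆`. -/
structure AdequateTransversalOn (mul : α → α → α) (U S0 : Set α) where
  sub : S0 ⊆ U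
  mul_mem : ∀ a ∈ S0, ∀ b ∈ S0, mul a b ∈ S0
  bar : α → α
  e : α → α
  f : α → α
  plus : α → α
  star : α → α
  plus_mem : ∀ a ∈ S0, plus a ∈ S0
  plus_idem : ∀ a ∈ S0, Idem mul (plus a)
  plus_rstar : ∀ a ∈ S0, RStarOn mul U a (plus a)
  star_mem : ∀ a ∈ S0, star a ∈ S0
  star_idem : ∀ a ∈ S0, Idem mul (star a)
  star_lstar : ∀ a ∈ S0, LStarOn mul U a (star a)
  idem_comm : ∀ u ∈ S0, ∀ v ∈ S0, Idem mul u → Idem mul v → mul u v = mul v u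
  bar_mem : ∀ x ∈ U, bar x ∈ S0
  e_mem : ∀ x ∈ U, e x ∈ U
  f_mem : ∀ x ∈ U, f x ∈ U
  e_idem : ∀ x ∈ U, Idem mul (e x)
  f_idem : ∀ x ∈ U, Idem mul (f x)
  decomp : ∀ x ∈ U, x = mul (mul (e x) (bar x)) (f x)
  e_greenL : ∀ x ∈ U, GreenLOn mul U (e x) (plus (bar x))
  f_greenR : ∀ x ∈ U, GreenROn mul U (f x) (star (bar x))
  unique : ∀ x ∈ U, ∀ s ∈ S0, ∀ e' ∈ U, ∀ f' ∈ U, Idem mul e' → Idem mul f' →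
      x = mul (mul e' s) f' → GreenLOn mul U e' (plus s) → GreenROn mul U f' (star s) →
      s = bar x ∧ e' = e x ∧ f' = f x

namespace AdequateTransversalOn

variable {mul : α → α → α} {U S0 : Set α}

/-- `R = {x ∈ U : e_x = e_{x̄}}`. -/
def Rset (T : AdequateTransversalOn mul U S0) : Set α :=
  {x | x ∈ U ∧ T.e x = T.e (T.bar x)}

/-- `L = {x ∈ U : f_x = f_{x̄}}`. -/
def Lset (T : AdequateTransversalOn mul U S0) : Set α :=
  {x | x ∈ U ∧ T.f x = T.f (T.bar x)}

/-- `I = {e_x : x ∈ U}`. -/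
def Iset (T : AdequateTransversalOn mul U S0) : Set α :=
  {y | ∃ x ∈ U, T.e x = y}

/-- `Λ = {f_x : x ∈ U}`. -/
def LamSet (T : AdequateTransversalOn mul U S0) : Set α :=
  {y | ∃ x ∈ U, T.f x = y}

/-- The transversal is multiplicative: `Λ I ⊆ E⁰`. -/
def IsMultiplicative (T : AdequateTransversalOn mul U S0) : Prop :=
  ∀ l ∈ T.LamSet, ∀ i ∈ T.Iset, mul l i ∈ S0 ∧ Idem mul (mul l i)

end AdequateTransversalOn

/-- The spined product set `T = L |×| R ⊆ S × S` attached to an adequate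
transversal of `S` (ambient carrier `U`). -/
def spSet {mul : α → α → α} {U S0 : Set α}
    (T : AdequateTransversalOn mul U S0) : Set (α × α) :=
  {p | p.1 ∈ T.Lset ∧ p.2 ∈ T.Rset ∧ T.bar p.1 = T.bar p.2}

/-- The multiplication `(x,a)(y,b) = (e_x(ay), (ay) f_b)` on the spined product. -/
def spMul {mul : α → α → α} {U S0 : Set α}
    (T : AdequateTransversalOn mul U S0) : α × α → α × α → α × α :=
  fun p q => (mul (T.e p.1) (mul p.2 q.1), mul (mul p.2 q.1) (T.f q.2))

/-- The map `φ : S → T`, `x ↦ (e_x x̄, x̄ f_x)`. -/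
def phiMap {mul : α → α → α} {U S0 : Set α}
    (T : AdequateTransversalOn mul U S0) : α → α × α :=
  fun x => (mul (T.e x) (T.bar x), mul (T.bar x) (T.f x))

/-- `T⁰ = {(s,s) : s ∈ S0}`. -/
def diagSet (S0 : Set α) : Set (α × α) := {p | ∃ s ∈ S0, p = (s, s)}

/-- Abstract spined product `L |×| R` over a common transversal `S⁰` (a type `γ`
embedded into `L` and `R` by `jL`, `jR`). -/
def absTset {mulL : α → α → α} {mulR : β → β → β} {jL : γ → α} {jR : γ → β}
    (TL : AdequateTransversalOn mulL Set.univ (Set.range jL))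
    (TR : AdequateTransversalOn mulR Set.univ (Set.range jR)) : Set (α × β) :=
  {p | ∃ s : γ, jL s = TL.bar p.1 ∧ jR s = TR.bar p.2}

/-- The multiplication `(x,a)(y,b) = (e_x(a∗y), (a∗y) f_b)`. -/
def absMul {mulL : α → α → α} {mulR : β → β → β} {jL : γ → α} {jR : γ → β}
    (TL : AdequateTransversalOn mulL Set.univ (Set.range jL))
    (TR : AdequateTransversalOn mulR Set.univ (Set.range jR))
    (st : β → α → γ) : α × β → α × β → α × β :=
  fun p q => (mulL (TL.e p.1) (jL (st p.2 q.1)), mulR (jR (st p.2 q.1)) (TR.f q.2))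

/-- `T⁰ = {(s,s) : s ∈ S⁰}` inside `L × R`, where `s` is viewed in `L` and in `R`. -/
def absT0 (jL : γ → α) (jR : γ → β) : Set (α × β) :=
  {p | ∃ s : γ, p = (jL s, jR s)}

/-- `S0` is an inverse transversal of the regular semigroup `U`: an inverse
subsemigroup meeting the set of inverses of each `x ∈ U` in exactly one
element `o x = x⁰`. -/
structure InverseTransversalOn (mul : α → α → α) (U S0 : Set α) where
  sub : S0 ⊆ U
  mul_mem : ∀ a ∈ S0, ∀ b ∈ S0, mul a b ∈ S0
  o : α → α
  o_mem : ∀ x ∈ U, o x ∈ S0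
  o_inv1 : ∀ x ∈ U, mul (mul x (o x)) x = x
  o_inv2 : ∀ x ∈ U, mul (mul (o x) x) (o x) = o x
  o_unique : ∀ x ∈ U, ∀ u ∈ S0, mul (mul x u) x = x → mul (mul u x) u = u → u = o x
  idem_comm : ∀ u ∈ S0, ∀ v ∈ S0, Idem mul u → Idem mul v → mul u v = mul v u

namespace InverseTransversalOn

variable {mul : α → α → α} {U S0 : Set α}

/-- `L = {x ∈ U : x⁰x ∈ E⁰}`. -/
def LsetI (T : InverseTransversalOn mul U S0) : Set α :=
  {x | x ∈ U ∧ mul (T.o x) x ∈ S0 ∧ Idem mul (mul (T.o x) x)}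

/-- `R = {x ∈ U : xx⁰ ∈ E⁰}`. -/
def RsetI (T : InverseTransversalOn mul U S0) : Set α :=
  {x | x ∈ U ∧ mul x (T.o x) ∈ S0 ∧ Idem mul (mul x (T.o x))}

end InverseTransversalOn

/-- Spined product set for an inverse transversal: `{(x,a) : x⁰ = a⁰}`. -/
def invSpSet {mul : α → α → α} {U S0 : Set α}
    (T : InverseTransversalOn mul U S0) : Set (α × α) :=
  {p | p.1 ∈ T.LsetI ∧ p.2 ∈ T.RsetI ∧ T.o p.1 = T.o p.2}

/-- The multiplication `(x,a)(y,b) = ((xx⁰)(ay), (ay)(b⁰b))`. -/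
def invSpMul {mul : α → α → α} {U S0 : Set α}
    (T : InverseTransversalOn mul U S0) : α × α → α × α → α × α :=
  fun p q => (mul (mul p.1 (T.o p.1)) (mul p.2 q.1),
              mul (mul p.2 q.1) (mul (T.o q.2) q.2))

/-- Abstract spined product for inverse transversals: `{(x,a) : x⁰ = a⁰}`. -/
def invAbsTset {mulL : α → α → α} {mulR : β → β → β} {jL : γ → α} {jR : γ → β}
    (TL : InverseTransversalOn mulL Set.univ (Set.range jL))
    (TR : InverseTransversalOn mulR Set.univ (Set.range jR)) : Set (α × β) :=
  {p | ∃ s : γ, jL s = TL.o p.1 ∧ jR s = TR.o p.2}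

/-- The multiplication `(x,a)(y,b) = ((xx⁰)(a∗y), (a∗y)(b⁰b))`. -/
def invAbsMul {mulL : α → α → α} {mulR : β → β → β} {jL : γ → α} {jR : γ → β}
    (TL : InverseTransversalOn mulL Set.univ (Set.range jL))
    (TR : InverseTransversalOn mulR Set.univ (Set.range jR))
    (st : β → α → γ) : α × β → α × β → α × β :=
  fun p q => (mulL (mulL p.1 (TL.o p.1)) (jL (st p.2 q.1)),
              mulR (jR (st p.2 q.1)) (mulR (TR.o q.2) q.2))

/-- The multiplication `(e,x)(g,w) = (e(aa⁻¹), a)`, `a = x((x⁻¹x)g)w`, on `I × S⁰`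
(Chen-style construction from a left normal band `I` with semilattice transversal
`E⁰ = E(S⁰)`; `σ` embeds idempotents of the inverse semigroup `γ` into the band
`β`, and `π : β → γ` is the semilattice-transversal map `e ↦ e⁰`). -/
def bandMul (mulB : β → β → β) (mulG : γ → γ → γ) (σ : γ → β) (π : β → γ)
    (inv : γ → γ) (p q : β × γ) : β × γ :=
  let a := mulG (mulG p.2 (π (mulB (σ (mulG (inv p.2) p.2)) q.1))) q.2
  (mulB p.1 (σ (mulG a (inv a))), a)

/-- `T = {(e,x) : e⁰ = xx⁻¹}`. -/
def bandTset (mulG : γ → γ → γ) (π : β → γ) (inv : γ → γ) : Set (β × γ) :=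
  {p | π p.1 = mulG p.2 (inv p.2)}

/-- `T⁰ = {(aa⁻¹, a) : a ∈ S⁰}` (with `aa⁻¹` viewed in the band via `σ`). -/
def bandT0 (mulG : γ → γ → γ) (σ : γ → β) (inv : γ → γ) : Set (β × γ) :=
  {p | ∃ s : γ, p = (σ (mulG s (inv s)), s)}

end Paper

namespace Paper

section Transport

variable {α β : Type*} {mulA : α → α → α} {mulB : β → β → β} {A : Set α} {B : Set β} {θ : α → β}

theorem SemigroupOn.of_bijOn (hθ : Set.BijOn θ A B)
    (hom : ∀ a ∈ A, ∀ b ∈ A, θ (mulA a b) = mulB (θ a) (θ b)) (hA : SemigroupOn mulA A) :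
    SemigroupOn mulB B := by
  obtain ⟨hcl, hassoc⟩ := hA
  refine ⟨fun p hp q hq => ?_, fun p hp q hq r hr => ?_⟩
  · obtain ⟨a, ha, rfl⟩ := hθ.surjOn hp
    obtain ⟨b, hb, rfl⟩ := hθ.surjOn hq
    rw [← hom a ha b hb]
    exact hθ.mapsTo (hcl a ha b hb)
  · obtain ⟨a, ha, rfl⟩ := hθ.surjOn hp
    obtain ⟨b, hb, rfl⟩ := hθ.surjOn hq
    obtain ⟨c, hc, rfl⟩ := hθ.surjOn hr
    rw [← hom a ha b hb, ← hom b hb c hc, ← hom _ (hcl a ha b hb) c hc,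
      ← hom a ha _ (hcl b hb c hc), hassoc a ha b hb c hc]

theorem RStarOn.map_bijOn (hθ : Set.BijOn θ A B)
    (hom : ∀ a ∈ A, ∀ b ∈ A, θ (mulA a b) = mulB (θ a) (θ b)) (hcl : ClosedOn mulA A)
    {a b : α} (ha : a ∈ A) (hb : b ∈ A) (h : RStarOn mulA A a b) :
    RStarOn mulB B (θ a) (θ b) := by
  refine ⟨fun p hp q hq => ?_, fun p hp => ?_⟩
  · obtain ⟨x, hx, rfl⟩ := hθ.surjOn hp
    obtain ⟨y, hy, rfl⟩ := hθ.surjOn hq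
    rw [← hom x hx a ha, ← hom y hy a ha, ← hom x hx b hb, ← hom y hy b hb,
      hθ.injOn.eq_iff (hcl x hx a ha) (hcl y hy a ha),
      hθ.injOn.eq_iff (hcl x hx b hb) (hcl y hy b hb)]
    exact h.1 x hx y hy
  · obtain ⟨x, hx, rfl⟩ := hθ.surjOn hp
    rw [← hom x hx a ha, ← hom x hx b hb, hθ.injOn.eq_iff (hcl x hx a ha) ha,
      hθ.injOn.eq_iff (hcl x hx b hb) hb]
    exact h.2 x hx

theorem LStarOn.map_bijOn (hθ : Set.BijOn θ A B)
    (hom : ∀ a ∈ A, ∀ b ∈ A, θ (mulA a b) = mulB (θ a) (θ b)) (hcl : ClosedOn mulA A)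
    {a b : α} (ha : a ∈ A) (hb : b ∈ A) (h : LStarOn mulA A a b) :
    LStarOn mulB B (θ a) (θ b) :=
  RStarOn.map_bijOn (mulA := fun x y => mulA y x) (mulB := fun x y => mulB y x) hθ
    (fun x hx y hy => hom y hy x hx) (fun x hx y hy => hcl y hy x hx) ha hb h

theorem AbundantOn.of_bijOn (hθ : Set.BijOn θ A B)
    (hom : ∀ a ∈ A, ∀ b ∈ A, θ (mulA a b) = mulB (θ a) (θ b)) (hcl : ClosedOn mulA A)
    (hA : AbundantOn mulA A) : AbundantOn mulB B := by
  intro p hp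
  obtain ⟨a, ha, rfl⟩ := hθ.surjOn hp
  obtain ⟨⟨e, he, hei, hae⟩, ⟨f, hf, hfi, haf⟩⟩ := hA a ha
  have idem {u : α} (hu : u ∈ A) (hui : Idem mulA u) : Idem mulB (θ u) :=
    (hom u hu u hu).symm.trans (congrArg θ hui)
  exact ⟨⟨θ e, hθ.mapsTo he, idem he hei, hae.map_bijOn hθ hom hcl ha he⟩,
    ⟨θ f, hθ.mapsTo hf, idem hf hfi, haf.map_bijOn hθ hom hcl ha hf⟩⟩

end Transport

section Green

variable {S : Type*} [Semigroup S]

theorem greenLOn_iff_of_idem {a b : S} (ha : a * a = a) (hb : b * b = b) :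
    GreenLOn (mulOf S) Set.univ a b ↔ a * b = a ∧ b * a = b := by
  constructor
  · rintro ⟨h₁, h₂⟩
    constructor
    · rcases h₁ with rfl | ⟨u, -, rfl⟩
      · exact ha
      · change u * b * b = u * b
        rw [mul_assoc, hb]
    · rcases h₂ with rfl | ⟨u, -, rfl⟩
      · exact ha
      · change u * a * a = u * a
        rw [mul_assoc, ha]
  · rintro ⟨h₁, h₂⟩
    exact ⟨Or.inr ⟨a, trivial, h₁⟩, Or.inr ⟨b, trivial, h₂⟩⟩

theorem greenROn_iff_of_idem {a b : S} (ha : a * a = a) (hb : b * b = b) :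
    GreenROn (mulOf S) Set.univ a b ↔ b * a = a ∧ a * b = b := by
  constructor
  · rintro ⟨h₁, h₂⟩
    constructor
    · rcases h₁ with rfl | ⟨u, -, rfl⟩
      · exact ha
      · change b * (b * u) = b * u
        rw [← mul_assoc, hb]
    · rcases h₂ with rfl | ⟨u, -, rfl⟩
      · exact ha
      · change a * (a * u) = a * u
        rw [← mul_assoc, ha]
  · rintro ⟨h₁, h₂⟩
    exact ⟨Or.inr ⟨a, trivial, h₁⟩, Or.inr ⟨b, trivial, h₂⟩⟩

end Green

namespace AdequateTransversalOn

variable {S : Type*} [Semigroup S] {S0 : Set S}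
  (T : AdequateTransversalOn (mulOf S) Set.univ S0)

theorem plus_mul_plus {s : S} (hs : s ∈ S0) : T.plus s * T.plus s = T.plus s :=
  T.plus_idem s hs

theorem star_mul_star {s : S} (hs : s ∈ S0) : T.star s * T.star s = T.star s :=
  T.star_idem s hs

theorem plus_mul {s : S} (hs : s ∈ S0) : T.plus s * s = s :=
  ((T.plus_rstar s hs).2 (T.plus s) trivial).2 (T.plus_idem s hs)

theorem mul_star {s : S} (hs : s ∈ S0) : s * T.star s = s :=
  ((T.star_lstar s hs).2 (T.star s) trivial).2 (T.star_idem s hs)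

theorem mul_plus_eq {s u : S} (hs : s ∈ S0) (h : u * s = s) : u * T.plus s = T.plus s :=
  ((T.plus_rstar s hs).2 u trivial).1 h

theorem star_mul_eq {s u : S} (hs : s ∈ S0) (h : s * u = s) : T.star s * u = T.star s :=
  ((T.star_lstar s hs).2 u trivial).1 h

theorem bar_mem' (x : S) : T.bar x ∈ S0 := T.bar_mem x trivial

theorem eq_mul (x : S) : x = T.e x * T.bar x * T.f x := T.decomp x trivial

theorem e_greenL_eqs (x : S) :
    T.e x * T.plus (T.bar x) = T.e x ∧ T.plus (T.bar x) * T.e x = T.plus (T.bar x) :=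
  (greenLOn_iff_of_idem (T.e_idem x trivial) (T.plus_idem _ (T.bar_mem' x))).1
    (T.e_greenL x trivial)

theorem f_greenR_eqs (x : S) :
    T.star (T.bar x) * T.f x = T.f x ∧ T.f x * T.star (T.bar x) = T.star (T.bar x) :=
  (greenROn_iff_of_idem (T.f_idem x trivial) (T.star_idem _ (T.bar_mem' x))).1
    (T.f_greenR x trivial)

/-- The data attached to `e' * s * f'` can be read off from the factors. -/
theorem data_mul {s e' f' : S} (hs : s ∈ S0) (he : e' * e' = e') (hf : f' * f' = f')
    (he₁ : e' * T.plus s = e') (he₂ : T.plus s * e' = T.plus s)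
    (hf₁ : T.star s * f' = f') (hf₂ : f' * T.star s = T.star s) :
    T.bar (e' * s * f') = s ∧ T.e (e' * s * f') = e' ∧ T.f (e' * s * f') = f' := by
  obtain ⟨h₁, h₂, h₃⟩ := T.unique (e' * s * f') trivial s hs e' trivial f' trivial he hf rfl
    ((greenLOn_iff_of_idem he (T.plus_idem s hs)).2 ⟨he₁, he₂⟩)
    ((greenROn_iff_of_idem hf (T.star_idem s hs)).2 ⟨hf₁, hf₂⟩)
  exact ⟨h₁.symm, h₂.symm, h₃.symm⟩

theorem data_of_mem {s : S} (hs : s ∈ S0) :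
    T.bar s = s ∧ T.e s = T.plus s ∧ T.f s = T.star s := by
  have hp := T.plus_mul_plus hs
  have ht := T.star_mul_star hs
  have h := T.data_mul hs hp ht hp hp ht ht
  rwa [T.plus_mul hs, T.mul_star hs] at h

theorem data_e_mul_bar (x : S) :
    T.bar (T.e x * T.bar x) = T.bar x ∧ T.e (T.e x * T.bar x) = T.e x ∧
      T.f (T.e x * T.bar x) = T.star (T.bar x) := by
  have hs := T.bar_mem' x
  have ht := T.star_mul_star hs
  have h := T.data_mul hs (T.e_idem x trivial) ht (T.e_greenL_eqs x).1 (T.e_greenL_eqs x).2 ht ht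
  rwa [mul_assoc, T.mul_star hs] at h

theorem data_bar_mul_f (x : S) :
    T.bar (T.bar x * T.f x) = T.bar x ∧ T.e (T.bar x * T.f x) = T.plus (T.bar x) ∧
      T.f (T.bar x * T.f x) = T.f x := by
  have hs := T.bar_mem' x
  have hp := T.plus_mul_plus hs
  have h := T.data_mul hs hp (T.f_idem x trivial) hp hp (T.f_greenR_eqs x).1 (T.f_greenR_eqs x).2
  rwa [T.plus_mul hs] at h

theorem phiMap_apply (x : S) : phiMap T x = (T.e x * T.bar x, T.bar x * T.f x) := rfl

theorem phiMap_mem (x : S) : phiMap T x ∈ spSet T := by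
  obtain ⟨h₁, -, h₃⟩ := T.data_e_mul_bar x
  obtain ⟨k₁, k₂, -⟩ := T.data_bar_mul_f x
  obtain ⟨-, m₂, m₃⟩ := T.data_of_mem (T.bar_mem' x)
  refine ⟨⟨trivial, ?_⟩, ⟨trivial, ?_⟩, ?_⟩
  · change T.f (T.e x * T.bar x) = T.f (T.bar (T.e x * T.bar x))
    rw [h₃, h₁, m₃]
  · change T.e (T.bar x * T.f x) = T.e (T.bar (T.bar x * T.f x))
    rw [k₂, k₁, m₂]
  · exact h₁.trans k₁.symm

theorem phiMap_injective : Function.Injective (phiMap T) := by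
  intro x y h
  obtain ⟨h₁, h₂⟩ := Prod.ext_iff.1 h
  change T.e x * T.bar x = T.e y * T.bar y at h₁
  change T.bar x * T.f x = T.bar y * T.f y at h₂
  have hf : T.f x = T.f y := by
    rw [← (T.data_bar_mul_f x).2.2, h₂, (T.data_bar_mul_f y).2.2]
  rw [T.eq_mul x, T.eq_mul y, h₁, hf]

theorem eq_e_mul_bar {x : S} (hx : x ∈ T.Lset) : T.e x * T.bar x = x := by
  have hs := T.bar_mem' x
  conv_rhs => rw [T.eq_mul x, hx.2, (T.data_of_mem hs).2.2, mul_assoc, T.mul_star hs]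

theorem eq_bar_mul_f {x : S} (hx : x ∈ T.Rset) : T.bar x * T.f x = x := by
  have hs := T.bar_mem' x
  conv_rhs => rw [T.eq_mul x, hx.2, (T.data_of_mem hs).2.1, T.plus_mul hs]

theorem phiMap_surjOn : Set.SurjOn (phiMap T) Set.univ (spSet T) := by
  rintro ⟨x, a⟩ ⟨hx, ha, hxa⟩
  change x ∈ T.Lset at hx
  change a ∈ T.Rset at ha
  change T.bar x = T.bar a at hxa
  obtain ⟨h₁, h₂, h₃⟩ := T.data_mul (T.bar_mem' x) (T.e_idem x trivial) (T.f_idem a trivial)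
    (T.e_greenL_eqs x).1 (T.e_greenL_eqs x).2
    (hxa ▸ (T.f_greenR_eqs a).1) (hxa ▸ (T.f_greenR_eqs a).2)
  refine ⟨T.e x * T.bar x * T.f a, trivial, ?_⟩
  rw [phiMap_apply, h₁, h₂, h₃, T.eq_e_mul_bar hx, hxa, T.eq_bar_mul_f ha]

theorem phiMap_bijOn : Set.BijOn (phiMap T) Set.univ (spSet T) :=
  ⟨fun x _ => T.phiMap_mem x, T.phiMap_injective.injOn, T.phiMap_surjOn⟩

theorem plus_mul_e {x c : S} (hc : c ∈ S0) (h : T.plus (T.bar x) * c = c) :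
    T.plus c * T.e x = T.plus c := by
  have hs := T.bar_mem' x
  have hcomm : T.plus c * T.plus (T.bar x) = T.plus c :=
    (T.idem_comm _ (T.plus_mem c hc) _ (T.plus_mem _ hs) (T.plus_idem c hc)
      (T.plus_idem _ hs)).trans (T.mul_plus_eq hc h)
  rw [← hcomm, mul_assoc, (T.e_greenL_eqs x).2]

theorem f_mul_star {y c : S} (hc : c ∈ S0) (h : c * T.star (T.bar y) = c) :
    T.f y * T.star c = T.star c := by
  have hs := T.bar_mem' y
  have hcomm : T.star (T.bar y) * T.star c = T.star c :=
    (T.idem_comm _ (T.star_mem _ hs) _ (T.star_mem c hc) (T.star_idem _ hs)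
      (T.star_idem c hc)).trans (T.star_mul_eq hc h)
  rw [← hcomm, ← mul_assoc, (T.f_greenR_eqs y).2]

theorem phiMap_mul (hq : QuasiIdealOn (mulOf S) Set.univ S0) (x y : S) :
    phiMap T (x * y) = spMul T (phiMap T x) (phiMap T y) := by
  obtain ⟨c, hc⟩ : ∃ c, c = T.bar x * T.f x * (T.e y * T.bar y) := ⟨_, rfl⟩
  have hcS : c ∈ S0 := by
    have h : T.bar x * (T.f x * T.e y) * T.bar y ∈ S0 :=
      hq _ (T.bar_mem' x) (T.f x * T.e y) trivial _ (T.bar_mem' y)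
    simpa only [hc, mul_assoc] using h
  have hcx : T.plus (T.bar x) * c = c := by
    rw [hc, ← mul_assoc, ← mul_assoc (T.plus _), T.plus_mul (T.bar_mem' x)]
  have hcy : c * T.star (T.bar y) = c := by
    rw [hc, mul_assoc, mul_assoc (T.e y), T.mul_star (T.bar_mem' y)]
  have hpe := T.plus_mul_e hcS hcx
  have hfs := T.f_mul_star hcS hcy
  have hpp := T.plus_mul_plus hcS
  have hss := T.star_mul_star hcS
  obtain ⟨h₁, h₂, h₃⟩ := T.data_mul (e' := T.e x * T.plus c) (f' := T.star c * T.f y) hcS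
    (by rw [mul_assoc, ← mul_assoc (T.plus c), hpe, hpp])
    (by rw [mul_assoc, ← mul_assoc (T.f y), hfs, ← mul_assoc, hss])
    (by rw [mul_assoc, hpp]) (by rw [← mul_assoc, hpe, hpp])
    (by rw [← mul_assoc, hss]) (by rw [mul_assoc, hfs, hss])
  have hxy : T.e x * T.plus c * c * (T.star c * T.f y) = x * y := by
    rw [mul_assoc (T.e x), T.plus_mul hcS, mul_assoc (T.e x), ← mul_assoc c, T.mul_star hcS, hc]
    conv_rhs => rw [T.eq_mul x, T.eq_mul y]
    simp only [mul_assoc]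
  rw [hxy] at h₁ h₂ h₃
  have hR : spMul T (phiMap T x) (phiMap T y) =
      (T.e (T.e x * T.bar x) * (T.bar x * T.f x * (T.e y * T.bar y)),
        T.bar x * T.f x * (T.e y * T.bar y) * T.f (T.bar y * T.f y)) := rfl
  rw [hR, phiMap_apply, h₁, h₂, h₃, (T.data_e_mul_bar x).2.1, (T.data_bar_mul_f y).2.2, ← hc,
    mul_assoc, T.plus_mul hcS, ← mul_assoc, T.mul_star hcS]

end AdequateTransversalOn

end Paper

open Paper in
/-- Let `S⁰` be a quasi-ideal adequate transversal of an abundant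
semigroup `S` and `T = L |×| R` with `(x,a)(y,b) = (e_x a y, a y f_b)`.  Then
`φ : S → T`, `x ↦ (e_x x̄, x̄ f_x)` is a semigroup isomorphism; in particular `T`
is an abundant semigroup isomorphic to `S`. -/
theorem stmt5 {S : Type*} [Semigroup S] (S0 : Set S)
    (hS : AbundantOn (mulOf S) Set.univ)
    (T : AdequateTransversalOn (mulOf S) Set.univ S0)
    (hq : QuasiIdealOn (mulOf S) Set.univ S0) :
    SemigroupOn (spMul T) (spSet T) ∧
    AbundantOn (spMul T) (spSet T) ∧
    Set.BijOn (phiMap T) Set.univ (spSet T) ∧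
    (∀ x y : S, phiMap T (x * y) = spMul T (phiMap T x) (phiMap T y)) := by
  have hcl : ClosedOn (mulOf S) Set.univ := fun _ _ _ _ => trivial
  have hbij := T.phiMap_bijOn
  have hom := T.phiMap_mul hq
  exact ⟨.of_bijOn hbij (fun x _ y _ => hom x y) ⟨hcl, fun x _ y _ z _ => mul_assoc x y z⟩,
    .of_bijOn hbij (fun x _ y _ => hom x y) hcl hS, hbij, hom⟩
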